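/- Let A and V be bounded self-adjoint operators on a separable infinite-dimensional complex Hilbert space H with V Hilbert–Schmidt. Set a = inf σ(A) − ‖V‖ and b = sup σ(A) + ‖V‖. Then there exists a unique real-valued function η ∈ L¹([a,b]) such that for every polynomial p, Tr[p(A+V) − p(A) − D^{(1)}p(A)(V) − (1/2) D^{(2)}p(A)(V,V)] = ∫_a^b p'''(λ) η(λ) dλ; moreover ∫_a^b η(λ) dλ = (1/6) Tr(V³) and ‖η‖_{L¹} ≤ (b−a)‖V‖₂². -/

import Mathlib

open MeasureTheory
noncomputable section

local notation "⟪" x ", " y "⟫" => @inner ℂ _ _ x y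

variable {H : Type} [NormedAddCommGroup H] [InnerProductSpace ℂ H] [CompleteSpace H]

/-- The trace of an operator, computed along a Hilbert basis indexed by `ℕ`. -/
def traceAlong (e : HilbertBasis ℕ ℂ H) (T : H →L[ℂ] H) : ℂ :=
  ∑' n, ⟪e n, T (e n)⟫

/-- `T` is a Hilbert–Schmidt operator. -/
def IsHS (e : HilbertBasis ℕ ℂ H) (T : H →L[ℂ] H) : Prop :=
  Summable fun n => ‖T (e n)‖ ^ 2

/-- The squared Hilbert–Schmidt norm `‖T‖₂²`. -/
def hsNormSq (e : HilbertBasis ℕ ℂ H) (T : H →L[ℂ] H) : ℝ :=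
  ∑' n, ‖T (e n)‖ ^ 2

/-- The absolute value `|T| = (T^*T)^{1/2}`. -/
def absCLM (T : H →L[ℂ] H) : H →L[ℂ] H := CFC.sqrt (star T * T)

/-- `T` is trace class. -/
def IsTraceClass (e : HilbertBasis ℕ ℂ H) (T : H →L[ℂ] H) : Prop :=
  Summable fun n => (⟪e n, absCLM T (e n)⟫).re

/-- `D¹(A^r)(V) = ∑_{j=0}^{r-1} A^{r-j-1} V A^j`. -/
def D1pow (A V : H →L[ℂ] H) (r : ℕ) : H →L[ℂ] H :=
  ∑ j ∈ Finset.range r, A ^ (r - 1 - j) * V * A ^ j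

/-- `D²(A^r)(X,Y)`, the second Fréchet derivative of `X ↦ X^r` at `A`. -/
def D2pow (A X Y : H →L[ℂ] H) (r : ℕ) : H →L[ℂ] H :=
  (∑ j ∈ Finset.range (r - 1), ∑ k ∈ Finset.range (r - 1 - j),
      A ^ (r - 2 - j - k) * X * A ^ k * Y * A ^ j)
    + ∑ j ∈ Finset.Icc 1 (r - 1), ∑ k ∈ Finset.range j,
      A ^ (r - 1 - j) * Y * A ^ k * X * A ^ (j - 1 - k)

/-- First Fréchet derivative `D¹p(A)(V)` of `X ↦ p(X)` at `A` for a polynomial `p`,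
extended linearly from the monomial formula. -/
def D1poly (A V : H →L[ℂ] H) (p : Polynomial ℝ) : H →L[ℂ] H :=
  p.sum fun i c => c • D1pow A V i

/-- Second Fréchet derivative `D²p(A)(X,Y)` of `X ↦ p(X)` at `A` for a polynomial `p`. -/
def D2poly (A X Y : H →L[ℂ] H) (p : Polynomial ℝ) : H →L[ℂ] H :=
  p.sum fun i c => c • D2pow A X Y i

/-- The third-order Taylor remainder `p(A+V) − p(A) − D¹p(A)(V) − ½D²p(A)(V,V)`. -/
def remainder3 (A V : H →L[ℂ] H) (p : Polynomial ℝ) : H →L[ℂ] H :=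
  Polynomial.aeval (A + V) p - Polynomial.aeval A p
    - D1poly A V p - (1 / 2 : ℝ) • D2poly A V V p

set_option linter.unusedSectionVars false

namespace IsHS

variable {e : HilbertBasis ℕ ℂ H} {S T : H →L[ℂ] H}

theorem mul_left (hT : IsHS e T) (B : H →L[ℂ] H) : IsHS e (B * T) := by
  refine Summable.of_nonneg_of_le (fun n => by positivity) (fun n => ?_)
    (Summable.mul_left (‖B‖ ^ 2) hT)
  rw [← mul_pow]
  exact pow_le_pow_left₀ (norm_nonneg _) (B.le_opNorm _) 2

theorem add (hS : IsHS e S) (hT : IsHS e T) : IsHS e (S + T) := by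
  refine Summable.of_nonneg_of_le (fun n => by positivity) (fun n => ?_)
    ((Summable.add hS hT).mul_left 2)
  have h : ‖(S + T) (e n)‖ ≤ ‖S (e n)‖ + ‖T (e n)‖ := norm_add_le _ _
  nlinarith [sq_nonneg (‖S (e n)‖ - ‖T (e n)‖), norm_nonneg ((S + T) (e n))]

theorem smul (hT : IsHS e T) (c : ℂ) : IsHS e (c • T) := by
  refine (Summable.mul_left (‖c‖ ^ 2) hT).congr fun n => ?_
  simp [norm_smul, mul_pow]

end IsHS

theorem hasSum_norm_inner_sq (e : HilbertBasis ℕ ℂ H) (x : H) :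
    HasSum (fun m => ‖⟪e m, x⟫‖ ^ 2) (‖x‖ ^ 2) := by
  have h := e.hasSum_inner_mul_inner x x
  rw [inner_self_eq_norm_sq_to_K] at h
  have h2 := Complex.hasSum_re h
  convert h2 using 1
  · ext m
    rw [← inner_conj_symm x (e m), ← Complex.normSq_eq_conj_mul_self, Complex.ofReal_re,
      Complex.normSq_eq_norm_sq]
  · norm_cast

theorem IsHS.summable_matrix {e : HilbertBasis ℕ ℂ H} {T : H →L[ℂ] H} (hT : IsHS e T) :
    Summable fun q : ℕ × ℕ => ‖⟪e q.2, T (e q.1)⟫‖ ^ 2 := by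
  refine (summable_prod_of_nonneg fun q => sq_nonneg _).2
    ⟨fun n => (hasSum_norm_inner_sq e (T (e n))).summable, ?_⟩
  simp only [(hasSum_norm_inner_sq e _).tsum_eq]
  exact hT

theorem IsHS.star {e : HilbertBasis ℕ ℂ H} {T : H →L[ℂ] H} (hT : IsHS e T) :
    IsHS e (star T) := by
  change Summable fun n => ‖(Star.star T) (e n)‖ ^ 2
  have h := hT.summable_matrix.prod_symm
  have h2 : Summable fun q : ℕ × ℕ => ‖⟪e q.2, (Star.star T) (e q.1)⟫‖ ^ 2 := by
    refine h.congr fun q => ?_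
    rw [ContinuousLinearMap.star_eq_adjoint, ContinuousLinearMap.adjoint_inner_right,
      norm_inner_symm]
    rfl
  simpa only [(hasSum_norm_inner_sq e _).tsum_eq] using
    ((summable_prod_of_nonneg fun q => sq_nonneg _).1 h2).2

theorem IsHS.mul_right {e : HilbertBasis ℕ ℂ H} {T : H →L[ℂ] H} (hT : IsHS e T)
    (B : H →L[ℂ] H) : IsHS e (T * B) := by
  simpa using (hT.star.mul_left (Star.star B)).star

theorem hsNormSq_star {e : HilbertBasis ℕ ℂ H} {T : H →L[ℂ] H} (hT : IsHS e T) :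
    hsNormSq e (star T) = hsNormSq e T := by
  unfold hsNormSq
  simp_rw [← (hasSum_norm_inner_sq e _).tsum_eq]
  rw [Summable.tsum_comm (hT.summable_matrix.congr fun q => ?_)]
  · simp only [ContinuousLinearMap.star_eq_adjoint, ContinuousLinearMap.adjoint_inner_right]
    refine tsum_congr fun m => tsum_congr fun n => ?_
    rw [norm_inner_symm]
  · simp only [ContinuousLinearMap.star_eq_adjoint, ContinuousLinearMap.adjoint_inner_right]
    simp only [Function.uncurry]
    rw [norm_inner_symm]

theorem hsNormSq_nonneg (e : HilbertBasis ℕ ℂ H) (T : H →L[ℂ] H) : 0 ≤ hsNormSq e T :=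
  tsum_nonneg fun _ => by positivity

theorem hsNormSq_mul_left_le {e : HilbertBasis ℕ ℂ H} {T : H →L[ℂ] H} (hT : IsHS e T)
    (B : H →L[ℂ] H) : hsNormSq e (B * T) ≤ ‖B‖ ^ 2 * hsNormSq e T := by
  unfold hsNormSq
  rw [← tsum_mul_left]
  refine Summable.tsum_le_tsum (fun n => ?_) (hT.mul_left B)
    (Summable.mul_left (‖B‖ ^ 2) hT)
  rw [← mul_pow]
  exact pow_le_pow_left₀ (norm_nonneg _) (B.le_opNorm _) 2

theorem hsNormSq_mul_right_le {e : HilbertBasis ℕ ℂ H} {T : H →L[ℂ] H} (hT : IsHS e T)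
    (B : H →L[ℂ] H) : hsNormSq e (T * B) ≤ ‖B‖ ^ 2 * hsNormSq e T := by
  rw [← hsNormSq_star (hT.mul_right B), ← hsNormSq_star hT, star_mul, ← norm_star B]
  exact hsNormSq_mul_left_le hT.star _

/-- The Hilbert–Schmidt operators as a submodule of the bounded operators. -/
def hsSubmodule (e : HilbertBasis ℕ ℂ H) : Submodule ℂ (H →L[ℂ] H) where
  carrier := {T | IsHS e T}
  add_mem' := IsHS.add
  zero_mem' := by simp [IsHS]
  smul_mem' c _ hT := hT.smul c

/-- The linear span of the products of two Hilbert–Schmidt operators. -/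
def hsProducts (e : HilbertBasis ℕ ℂ H) : Submodule ℂ (H →L[ℂ] H) :=
  hsSubmodule e * hsSubmodule e

section Trace

variable {e : HilbertBasis ℕ ℂ H} {S T : H →L[ℂ] H}

theorem IsHS.mul_mem_hsProducts (hS : IsHS e S) (hT : IsHS e T) : S * T ∈ hsProducts e :=
  Submodule.mul_mem_mul (show S ∈ hsSubmodule e from hS) (show T ∈ hsSubmodule e from hT)

theorem mul_mem_hsProducts_right (hT : T ∈ hsProducts e) (B : H →L[ℂ] H) :
    T * B ∈ hsProducts e := by
  refine Submodule.mul_induction_on hT (fun X hX Y hY => ?_) fun X Y hX hY => ?_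
  · rw [mul_assoc]
    exact IsHS.mul_mem_hsProducts hX (IsHS.mul_right hY B)
  · rw [add_mul]
    exact add_mem hX hY

theorem IsHS.norm_inner_mul_le (n : ℕ) :
    ‖⟪e n, (S * T) (e n)⟫‖ ≤ (‖(Star.star S) (e n)‖ ^ 2 + ‖T (e n)‖ ^ 2) / 2 := by
  have h : ⟪e n, (S * T) (e n)⟫ = ⟪(Star.star S) (e n), T (e n)⟫ := by
    rw [ContinuousLinearMap.star_eq_adjoint, ContinuousLinearMap.adjoint_inner_left]
    rfl
  rw [h]
  have := norm_inner_le_norm (𝕜 := ℂ) ((Star.star S) (e n)) (T (e n))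
  nlinarith [sq_nonneg (‖(Star.star S) (e n)‖ - ‖T (e n)‖)]

theorem IsHS.summable_inner_mul (hS : IsHS e S) (hT : IsHS e T) :
    Summable fun n => ⟪e n, (S * T) (e n)⟫ :=
  Summable.of_norm_bounded ((Summable.add hS.star hT).div_const 2)
    fun _ => IsHS.norm_inner_mul_le _

theorem summable_inner_of_mem_hsProducts (hT : T ∈ hsProducts e) :
    Summable fun n => ⟪e n, T (e n)⟫ := by
  refine Submodule.mul_induction_on hT (fun X hX Y hY => IsHS.summable_inner_mul hX hY)
    fun X Y hX hY => ?_
  simpa [inner_add_right] using hX.add hY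

theorem traceAlong_mul_comm (hS : IsHS e S) (hT : IsHS e T) :
    traceAlong e (S * T) = traceAlong e (T * S) := by
  have key : ∀ (X Y : H →L[ℂ] H) (n : ℕ), ⟪e n, (X * Y) (e n)⟫
      = ∑' m, ⟪e n, X (e m)⟫ * ⟪e m, Y (e n)⟫ := by
    intro X Y n
    have h := (e.hasSum_inner_mul_inner ((Star.star X) (e n)) (Y (e n))).tsum_eq
    simp only [ContinuousLinearMap.star_eq_adjoint, ContinuousLinearMap.adjoint_inner_left] at h
    exact h.symm
  unfold traceAlong
  simp_rw [key]
  rw [Summable.tsum_comm]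
  · exact tsum_congr fun n => tsum_congr fun m => mul_comm _ _
  · refine Summable.of_norm_bounded
      ((hS.summable_matrix.add hT.summable_matrix.prod_symm).div_const 2) fun q => ?_
    simp only [Function.uncurry, Prod.swap, norm_mul]
    nlinarith [sq_nonneg (‖⟪e q.2, S (e q.1)⟫‖ - ‖⟪e q.1, T (e q.2)⟫‖)]

theorem traceAlong_star_mul_self (e : HilbertBasis ℕ ℂ H) (T : H →L[ℂ] H) :
    traceAlong e (star T * T) = (hsNormSq e T : ℂ) := by
  unfold traceAlong hsNormSq
  rw [Complex.ofReal_tsum]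
  refine tsum_congr fun n => ?_
  rw [mul_apply_eq_comp, ContinuousLinearMap.star_eq_adjoint,
    ContinuousLinearMap.adjoint_inner_right, inner_self_eq_norm_sq_to_K]
  norm_cast

theorem norm_traceAlong_mul_le (hS : IsHS e S) (hT : IsHS e T) :
    ‖traceAlong e (S * T)‖ ≤ (hsNormSq e S + hsNormSq e T) / 2 := by
  rw [← hsNormSq_star hS]
  have h := Summable.add hS.star hT
  refine (norm_tsum_le_tsum_norm (hS.summable_inner_mul hT).norm).trans ?_
  refine (Summable.tsum_le_tsum (fun n => IsHS.norm_inner_mul_le n)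
    (hS.summable_inner_mul hT).norm (h.div_const 2)).trans ?_
  rw [tsum_div_const, Summable.tsum_add hS.star hT]
  rfl

theorem traceAlong_star (T : H →L[ℂ] H) :
    traceAlong e (star T) = (starRingEnd ℂ) (traceAlong e T) := by
  unfold traceAlong
  rw [Complex.conj_tsum]
  refine tsum_congr fun n => ?_
  rw [ContinuousLinearMap.star_eq_adjoint, ContinuousLinearMap.adjoint_inner_right,
    inner_conj_symm]

/-- A linear functional on all bounded operators that agrees with the trace on sums of
products of Hilbert–Schmidt operators. -/
theorem exists_linearMap_eq_traceAlong (e : HilbertBasis ℕ ℂ H) :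
    ∃ τ : (H →L[ℂ] H) →ₗ[ℂ] ℂ, ∀ T ∈ hsProducts e, τ T = traceAlong e T := by
  let f : hsProducts e →ₗ[ℂ] ℂ :=
    { toFun := fun T => traceAlong e T
      map_add' := fun X Y => by
        simp only [traceAlong, Submodule.coe_add, add_apply, inner_add_right]
        exact Summable.tsum_add (summable_inner_of_mem_hsProducts X.2)
          (summable_inner_of_mem_hsProducts Y.2)
      map_smul' := fun c X => by
        simp only [traceAlong, Submodule.coe_smul, smul_apply,
          inner_smul_right, tsum_mul_left, RingHom.id_apply, smul_eq_mul] }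
  obtain ⟨τ, hτ⟩ := LinearMap.exists_extend f
  exact ⟨τ, fun T hT => congrArg (fun g => g ⟨T, hT⟩) hτ⟩

end Trace

theorem exists_bound_sum_inner_of_mem_hsProducts {e : HilbertBasis ℕ ℂ H} {T : H →L[ℂ] H}
    (hT : T ∈ hsProducts e) :
    ∃ C : ℝ, ∀ U : H →L[ℂ] H, ‖U‖ ≤ 1 → ∀ F : Finset ℕ,
      ‖∑ n ∈ F, ⟪e n, (U * T) (e n)⟫‖ ≤ C := by
  refine Submodule.mul_induction_on hT (fun X hX Y hY => ?_) fun X Y hX hY => ?_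
  · refine ⟨(hsNormSq e X + hsNormSq e Y) / 2, fun U hU F => ?_⟩
    have hX' : IsHS e X := hX
    have hY' : IsHS e Y := hY
    have hUX : IsHS e (U * X) := hX'.mul_left U
    have h1 : hsNormSq e (star (U * X)) ≤ hsNormSq e X := by
      rw [hsNormSq_star hUX]
      refine (hsNormSq_mul_left_le hX' U).trans ?_
      nlinarith [hsNormSq_nonneg e X, norm_nonneg U,
        mul_nonneg (hsNormSq_nonneg e X) (sub_nonneg.2 (pow_le_one₀ (n := 2) (norm_nonneg U) hU))]
    have h2 : ∑ n ∈ F, ‖(star (U * X)) (e n)‖ ^ 2 ≤ hsNormSq e (star (U * X)) :=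
      hUX.star.sum_le_tsum F fun _ _ => sq_nonneg _
    have h3 : ∑ n ∈ F, ‖Y (e n)‖ ^ 2 ≤ hsNormSq e Y :=
      hY'.sum_le_tsum F fun _ _ => sq_nonneg _
    refine (norm_sum_le_of_le F (f := fun n => ⟪e n, (U * (X * Y)) (e n)⟫)
      (n := fun n => (‖(star (U * X)) (e n)‖ ^ 2 + ‖Y (e n)‖ ^ 2) / 2) fun n _ => ?_).trans ?_
    · rw [← mul_assoc]
      exact IsHS.norm_inner_mul_le n
    · rw [← Finset.sum_div, Finset.sum_add_distrib]
      linarith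
  · obtain ⟨C, hC⟩ := hX
    obtain ⟨D, hD⟩ := hY
    refine ⟨C + D, fun U hU F => ?_⟩
    simp only [mul_add, add_apply, inner_add_right, Finset.sum_add_distrib]
    exact (norm_add_le _ _).trans (add_le_add (hC U hU F) (hD U hU F))

theorem exists_contraction_mul_near_absCLM (T : H →L[ℂ] H) {ε : ℝ} (hε : 0 < ε) :
    ∃ U : H →L[ℂ] H, ‖U‖ ≤ 1 ∧ ‖absCLM T - U * T‖ ≤ ε := by
  have hN0 : 0 ≤ star T * T := star_mul_self_nonneg T
  have hN : IsSelfAdjoint (star T * T) := IsSelfAdjoint.of_nonneg hN0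
  have hpos : ∀ x : ℝ, 0 < √x + ε := fun x => by positivity
  have hspec : ∀ x ∈ spectrum ℝ (star T * T), 0 ≤ x := fun x hx => spectrum_nonneg_of_nonneg hN0 hx
  have hg : Continuous fun x : ℝ => (√x + ε)⁻¹ :=
    (Real.continuous_sqrt.add continuous_const).inv₀ fun x => (hpos x).ne'
  have hG : IsSelfAdjoint (cfc (fun x : ℝ => (√x + ε)⁻¹) (star T * T)) := cfc_predicate _ _
  have hmul : cfc (fun x : ℝ => (√x + ε)⁻¹) (star T * T) * (star T * T)
      = cfc (fun x : ℝ => (√x + ε)⁻¹ * x) (star T * T) := by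
    rw [cfc_mul (fun x : ℝ => (√x + ε)⁻¹) (fun x => x) _ hg.continuousOn continuousOn_id,
      cfc_id' ℝ (star T * T)]
  refine ⟨cfc (fun x : ℝ => (√x + ε)⁻¹) (star T * T) * star T, ?_, ?_⟩
  · have h : ‖cfc (fun x : ℝ => (√x + ε)⁻¹ * x * (√x + ε)⁻¹) (star T * T)‖ ≤ 1 := by
      refine norm_cfc_le zero_le_one fun x hx => ?_
      have hx0 := hspec x hx
      have hs := Real.sqrt_nonneg x
      have hp := hpos x
      rw [Real.norm_of_nonneg (by positivity)]
      rw [show (√x + ε)⁻¹ * x * (√x + ε)⁻¹ = x / (√x + ε) ^ 2 by field_simp,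
        div_le_one (by positivity)]
      nlinarith [Real.sq_sqrt hx0]
    rw [cfc_mul (fun x : ℝ => (√x + ε)⁻¹ * x) (fun x : ℝ => (√x + ε)⁻¹) _
      (hg.mul continuous_id).continuousOn hg.continuousOn, ← hmul] at h
    have h2 : ∀ G : H →L[ℂ] H, IsSelfAdjoint G →
        G * (star T * T) * G = (G * star T) * star (G * star T) := fun G hG => by
      rw [star_mul, star_star, hG.star_eq]
      simp only [mul_assoc]
    rw [h2 _ hG, CStarRing.norm_self_mul_star] at h
    nlinarith [norm_nonneg (cfc (fun x : ℝ => (√x + ε)⁻¹) (star T * T) * star T)]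
  · rw [mul_assoc, hmul, absCLM, CFC.sqrt_eq_real_sqrt _ hN0,
      cfcₙ_eq_cfc,
      ← cfc_sub Real.sqrt (fun x : ℝ => (√x + ε)⁻¹ * x) _ Real.continuous_sqrt.continuousOn
        (hg.mul continuous_id).continuousOn]
    refine norm_cfc_le hε.le fun x hx => ?_
    have hx0 := hspec x hx
    have hs := Real.sqrt_nonneg x
    have hp := hpos x
    rw [show √x - (√x + ε)⁻¹ * x = ε * √x / (√x + ε) by
      field_simp
      nlinarith [Real.sq_sqrt hx0], Real.norm_of_nonneg (by positivity), div_le_iff₀ hp]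
    nlinarith

theorem isTraceClass_of_mem_hsProducts {e : HilbertBasis ℕ ℂ H} {T : H →L[ℂ] H}
    (hT : T ∈ hsProducts e) : IsTraceClass e T := by
  obtain ⟨C, hC⟩ := exists_bound_sum_inner_of_mem_hsProducts hT
  have hpos : ∀ n, 0 ≤ (⟪e n, absCLM T (e n)⟫).re := fun n => by
    have h : 0 ≤ absCLM T := CFC.sqrt_nonneg _
    rw [ContinuousLinearMap.nonneg_iff_isPositive] at h
    exact h.re_inner_nonneg_right (e n)
  refine summable_of_sum_le hpos (c := C) fun F => ?_
  refine le_of_forall_pos_le_add fun δ hδ => ?_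
  obtain ⟨U, hU, hUT⟩ := exists_contraction_mul_near_absCLM T
    (ε := δ / (F.card + 1)) (by positivity)
  have h1 : ∀ n, (⟪e n, absCLM T (e n)⟫).re
      ≤ (⟪e n, (U * T) (e n)⟫).re + δ / (F.card + 1) := fun n => by
    have h2 : ‖⟪e n, (absCLM T - U * T) (e n)⟫‖ ≤ δ / (F.card + 1) := by
      refine (norm_inner_le_norm _ _).trans ?_
      have := (absCLM T - U * T).le_opNorm (e n)
      simp only [e.orthonormal.1 n, mul_one, one_mul] at this ⊢
      exact this.trans hUT
    have h3 := (Complex.re_le_norm _).trans h2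
    rw [sub_apply, inner_sub_right, Complex.sub_re] at h3
    linarith
  calc ∑ n ∈ F, (⟪e n, absCLM T (e n)⟫).re
      ≤ ∑ n ∈ F, ((⟪e n, (U * T) (e n)⟫).re + δ / (F.card + 1)) :=
        Finset.sum_le_sum fun n _ => h1 n
    _ = (∑ n ∈ F, ⟪e n, (U * T) (e n)⟫).re + F.card * (δ / (F.card + 1)) := by
        rw [Finset.sum_add_distrib, Complex.re_sum, Finset.sum_const, nsmul_eq_mul]
    _ ≤ C + δ := by
        refine add_le_add ((Complex.re_le_norm _).trans (hC U hU F)) ?_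
        rw [mul_div_assoc', div_le_iff₀ (by positivity)]
        nlinarith

theorem D1pow_succ (A V : H →L[ℂ] H) (r : ℕ) :
    D1pow A V (r + 1) = D1pow A V r * A + A ^ r * V := by
  unfold D1pow
  rw [Finset.sum_range_succ', Finset.sum_mul]
  congr 1
  refine Finset.sum_congr rfl fun j hj => ?_
  rw [pow_succ, show r + 1 - 1 - (j + 1) = r - 1 - j by omega]
  simp only [mul_assoc]

theorem D2pow_self_succ (A V : H →L[ℂ] H) (r : ℕ) :
    D2pow A V V (r + 1) = D2pow A V V r * A + (2 : ℂ) • (D1pow A V r * V) := by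
  rcases r with _ | r
  · simp [D2pow, D1pow]
  have hIcc : ∀ (n : ℕ) (f : ℕ → H →L[ℂ] H),
      ∑ j ∈ Finset.Icc 1 n, f j = ∑ j ∈ Finset.range n, f (j + 1) := by
    intro n f
    rw [Finset.range_eq_Ico, Finset.sum_Ico_add' f 0 n 1]
    rfl
  have h1 : ∑ j ∈ Finset.range (r + 1), ∑ k ∈ Finset.range (r + 1 - j),
        A ^ (r - j - k) * V * A ^ k * V * A ^ j
      = (∑ j ∈ Finset.range r, ∑ k ∈ Finset.range (r - j),
        A ^ (r - 1 - j - k) * V * A ^ k * V * A ^ j) * A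
        + (∑ k ∈ Finset.range (r + 1), A ^ (r - k) * V * A ^ k) * V := by
    rw [Finset.sum_range_succ', Finset.sum_mul, Finset.sum_mul]
    congr 1
    refine Finset.sum_congr rfl fun j hj => ?_
    rw [Finset.sum_mul, show r + 1 - (j + 1) = r - j by omega]
    refine Finset.sum_congr rfl fun k hk => ?_
    rw [pow_succ, show r - (j + 1) - k = r - 1 - j - k by omega]
    simp only [mul_assoc]
  have h2 : ∑ j ∈ Finset.range (r + 1), ∑ k ∈ Finset.range (j + 1),
        A ^ (r - j) * V * A ^ k * V * A ^ (j - k)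
      = (∑ j ∈ Finset.range r, ∑ k ∈ Finset.range (j + 1),
        A ^ (r - (j + 1)) * V * A ^ k * V * A ^ (j - k)) * A
        + (∑ k ∈ Finset.range (r + 1), A ^ (r - k) * V * A ^ k) * V := by
    have h3 : ∀ j, ∑ k ∈ Finset.range (j + 1), A ^ (r - j) * V * A ^ k * V * A ^ (j - k)
        = ∑ k ∈ Finset.range j, A ^ (r - j) * V * A ^ k * V * A ^ (j - k)
          + A ^ (r - j) * V * A ^ j * V := fun j => by
      rw [Finset.sum_range_succ]
      simp
    simp_rw [h3]
    rw [Finset.sum_add_distrib, ← Finset.sum_mul, Finset.sum_range_succ']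
    simp only [Finset.range_zero, Finset.sum_empty, add_zero]
    congr 1
    rw [Finset.sum_mul]
    refine Finset.sum_congr rfl fun j hj => ?_
    rw [Finset.sum_mul]
    refine Finset.sum_congr rfl fun k hk => ?_
    rw [show j + 1 - k = j - k + 1 by
      have := Finset.mem_range.1 hk
      omega, pow_succ]
    simp only [mul_assoc]
  unfold D2pow D1pow
  rw [hIcc, hIcc]
  simp only [Nat.add_sub_cancel, show r + 1 + 1 - 2 = r by omega,
    show r + 1 - 2 = r - 1 by omega, show ∀ j, r + 1 - (j + 1) = r - j by intro j; omega,
    Nat.sub_zero]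
  rw [h1, h2, add_mul, two_smul]
  abel

section Remainders

variable {e : HilbertBasis ℕ ℂ H} {A V : H →L[ℂ] H}

theorem D2pow_self_mem_hsProducts (hV : IsHS e V) (r : ℕ) : D2pow A V V r ∈ hsProducts e := by
  have h : ∀ B C D : H →L[ℂ] H, B * V * C * V * D ∈ hsProducts e := fun B C D => by
    refine mul_mem_hsProducts_right ?_ D
    exact ((hV.mul_left B).mul_right C).mul_mem_hsProducts hV
  exact add_mem (sum_mem fun j _ => sum_mem fun k _ => h _ _ _)
    (sum_mem fun j _ => sum_mem fun k _ => h _ _ _)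

theorem IsHS.pow_add_sub_pow (hV : IsHS e V) (r : ℕ) : IsHS e ((A + V) ^ r - A ^ r) := by
  change _ ∈ hsSubmodule e
  induction r with
  | zero => simp
  | succ r ih =>
    have h : (A + V) ^ (r + 1) - A ^ (r + 1) = ((A + V) ^ r - A ^ r) * A + (A + V) ^ r * V := by
      rw [pow_succ, pow_succ]
      noncomm_ring
    rw [h]
    exact add_mem (IsHS.mul_right ih A) (hV.mul_left _)

theorem pow_add_sub_pow_sub_D1pow_mem (hV : IsHS e V) (r : ℕ) :
    (A + V) ^ r - A ^ r - D1pow A V r ∈ hsProducts e := by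
  induction r with
  | zero => simp [D1pow]
  | succ r ih =>
    have h : (A + V) ^ (r + 1) - A ^ (r + 1) - D1pow A V (r + 1)
        = ((A + V) ^ r - A ^ r - D1pow A V r) * A + ((A + V) ^ r - A ^ r) * V := by
      rw [pow_succ, pow_succ, D1pow_succ]
      noncomm_ring
    rw [h]
    exact add_mem (mul_mem_hsProducts_right ih A)
      ((IsHS.pow_add_sub_pow hV r).mul_mem_hsProducts hV)

theorem D2poly_self_mem_hsProducts (hV : IsHS e V) (p : Polynomial ℝ) :
    D2poly A V V p ∈ hsProducts e :=
  sum_mem fun i _ => by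
    beta_reduce
    rw [← Complex.coe_smul]
    exact Submodule.smul_mem _ _ (D2pow_self_mem_hsProducts hV i)

theorem aeval_eq_polynomial_sum (A : H →L[ℂ] H) (p : Polynomial ℝ) :
    Polynomial.aeval A p = p.sum fun i c => c • A ^ i := by
  rw [Polynomial.aeval_eq_sum_range, Polynomial.sum_over_range]
  simp

theorem remainder3_mem_hsProducts (hV : IsHS e V) (p : Polynomial ℝ) :
    remainder3 A V p ∈ hsProducts e := by
  refine sub_mem ?_ ?_
  · rw [aeval_eq_polynomial_sum, aeval_eq_polynomial_sum, D1poly, Polynomial.sum, Polynomial.sum, Polynomial.sum,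
      ← Finset.sum_sub_distrib, ← Finset.sum_sub_distrib]
    refine sum_mem fun i _ => ?_
    rw [← smul_sub, ← smul_sub, ← Complex.coe_smul]
    exact Submodule.smul_mem _ _ (pow_add_sub_pow_sub_D1pow_mem hV i)
  · rw [← Complex.coe_smul]
    exact Submodule.smul_mem _ _ (D2poly_self_mem_hsProducts hV p)

/-- The linear map `p ↦ remainder3 A V p`. -/
def remainder3Linear (A V : H →L[ℂ] H) : Polynomial ℝ →ₗ[ℝ] (H →L[ℂ] H) where
  toFun := remainder3 A V
  map_add' p q := by
    have h : ∀ f : ℕ → H →L[ℂ] H, (p + q).sum (fun i c => c • f i)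
        = p.sum (fun i c => c • f i) + q.sum fun i c => c • f i := fun f =>
      Polynomial.sum_add_index p q _ (by simp) (by simp [add_smul])
    simp only [remainder3, D1poly, D2poly, h, map_add, smul_add]
    abel
  map_smul' c p := by
    have h : ∀ f : ℕ → H →L[ℂ] H, (c • p).sum (fun i c => c • f i)
        = c • p.sum (fun i c => c • f i) := fun f => by
      rw [Polynomial.sum_smul_index p c _ (by simp), Polynomial.sum, Polynomial.sum,
        Finset.smul_sum]
      simp [mul_smul]
    simp only [remainder3, D1poly, D2poly, h, map_smul, smul_sub, RingHom.id_apply]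
    rw [smul_comm c (1 / 2 : ℝ)]

theorem remainder3_X_sq (A V : H →L[ℂ] H) : remainder3 A V (Polynomial.X ^ 2) = 0 := by
  have h : ∀ f : ℕ → H →L[ℂ] H,
      (Polynomial.X ^ 2 : Polynomial ℝ).sum (fun i c => c • f i) = f 2 := fun f => by
    rw [← Polynomial.monomial_one_right_eq_X_pow, Polynomial.sum_monomial_index _ _ (by simp),
      one_smul]
  simp only [remainder3, D1poly, D2poly, h, D1pow_succ, D2pow_self_succ]
  simp [D1pow, D2pow, pow_two]
  rw [← Complex.coe_smul, smul_smul]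
  norm_num
  noncomm_ring

theorem remainder3_X_cube (A V : H →L[ℂ] H) : remainder3 A V (Polynomial.X ^ 3) = V ^ 3 := by
  have h : ∀ f : ℕ → H →L[ℂ] H,
      (Polynomial.X ^ 3 : Polynomial ℝ).sum (fun i c => c • f i) = f 3 := fun f => by
    rw [← Polynomial.monomial_one_right_eq_X_pow, Polynomial.sum_monomial_index _ _ (by simp),
      one_smul]
  simp only [remainder3, D1poly, D2poly, h, D1pow_succ, D2pow_self_succ]
  simp [D1pow, D2pow, pow_succ]
  simp only [← Complex.coe_smul, smul_smul]
  norm_num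
  noncomm_ring

/-- Linear functionals of `s ↦ p (A + s V)` are differentiable, with the expected derivative. -/
theorem hasDerivAt_linearMap_pow (τ : (H →L[ℂ] H) →ₗ[ℂ] ℂ) (A V : H →L[ℂ] H) (r : ℕ) (s : ℝ) :
    HasDerivAt (fun s : ℝ => τ ((A + (s : ℂ) • V) ^ r)) (τ (D1pow (A + (s : ℂ) • V) V r)) s := by
  induction r generalizing τ with
  | zero => simpa [D1pow] using hasDerivAt_const s (τ 1)
  | succ r ih =>
    have h1 := ih (τ ∘ₗ LinearMap.mulRight ℂ A)
    have h2 := (hasDerivAt_id s).ofReal_comp.fun_mul (ih (τ ∘ₗ LinearMap.mulRight ℂ V))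
    have h := h1.fun_add h2
    simp only [LinearMap.comp_apply, LinearMap.mulRight_apply, id_eq, ← smul_eq_mul, ← map_smul,
      ← map_add, Complex.ofReal_one, one_smul] at h
    simp only [smul_eq_mul] at h
    convert h using 3
    · rfl
    · rw [pow_succ, mul_add, mul_smul_comm]
    · rw [D1pow_succ, mul_add, mul_smul_comm]
      abel

theorem hasDerivAt_linearMap_D1pow (τ : (H →L[ℂ] H) →ₗ[ℂ] ℂ) (A V : H →L[ℂ] H) (r : ℕ) (s : ℝ) :
    HasDerivAt (fun s : ℝ => τ (D1pow (A + (s : ℂ) • V) V r))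
      (τ (D2pow (A + (s : ℂ) • V) V V r)) s := by
  induction r generalizing τ with
  | zero => simpa [D1pow, D2pow] using hasDerivAt_const s (0 : ℂ)
  | succ r ih =>
    have h1 := ih (τ ∘ₗ LinearMap.mulRight ℂ A)
    have h2 := (hasDerivAt_id s).ofReal_comp.fun_mul (ih (τ ∘ₗ LinearMap.mulRight ℂ V))
    have h3 := hasDerivAt_linearMap_pow (τ ∘ₗ LinearMap.mulRight ℂ V) A V r s
    have h := (h1.fun_add h2).fun_add h3
    simp only [LinearMap.comp_apply, LinearMap.mulRight_apply, id_eq, ← smul_eq_mul, ← map_smul,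
      ← map_add, Complex.ofReal_one, one_smul] at h
    simp only [smul_eq_mul] at h
    convert h using 3
    · rfl
    · rw [D1pow_succ, mul_add, mul_smul_comm]
    · rw [D2pow_self_succ, mul_add, mul_smul_comm, two_smul]
      abel

theorem hasDerivAt_linearMap_aeval (τ : (H →L[ℂ] H) →ₗ[ℂ] ℂ) (A V : H →L[ℂ] H)
    (p : Polynomial ℝ) (s : ℝ) :
    HasDerivAt (fun s : ℝ => τ (Polynomial.aeval (A + (s : ℂ) • V) p))
      (τ (D1poly (A + (s : ℂ) • V) V p)) s := by
  simp only [aeval_eq_polynomial_sum, D1poly, Polynomial.sum, map_sum, ← Complex.coe_smul, map_smul]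
  exact HasDerivAt.fun_sum fun i _ => (hasDerivAt_linearMap_pow τ A V i s).fun_const_smul _

theorem hasDerivAt_linearMap_D1poly (τ : (H →L[ℂ] H) →ₗ[ℂ] ℂ) (A V : H →L[ℂ] H)
    (p : Polynomial ℝ) (s : ℝ) :
    HasDerivAt (fun s : ℝ => τ (D1poly (A + (s : ℂ) • V) V p))
      (τ (D2poly (A + (s : ℂ) • V) V V p)) s := by
  simp only [D1poly, D2poly, Polynomial.sum, map_sum, ← Complex.coe_smul, map_smul]
  exact HasDerivAt.fun_sum fun i _ => (hasDerivAt_linearMap_D1pow τ A V i s).fun_const_smul _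

end Remainders

theorem sum_range_sum_range_succ (N : ℕ) (d : ℕ → ℂ) :
    ∑ j ∈ Finset.range N, ∑ k ∈ Finset.range (j + 1), d k
      = ∑ k ∈ Finset.range N, ((N : ℂ) - k) * d k := by
  induction N with
  | zero => simp
  | succ N ih =>
    rw [Finset.sum_range_succ, ih, Finset.sum_range_succ, Finset.sum_range_succ _ N, ← add_assoc,
      ← Finset.sum_add_distrib]
    push_cast
    congr 1
    · exact Finset.sum_congr rfl fun k _ => by ring
    · ring

theorem two_mul_sum_range_sum_range_succ (N : ℕ) (d : ℕ → ℂ)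
    (hd : ∀ k < N, d (N - 1 - k) = d k) :
    2 * ∑ j ∈ Finset.range N, ∑ k ∈ Finset.range (j + 1), d k
      = (N + 1) * ∑ k ∈ Finset.range N, d k := by
  have h1 := sum_range_sum_range_succ N d
  have h2 : ∑ k ∈ Finset.range N, ((N : ℂ) - k) * d k
      = ∑ k ∈ Finset.range N, ((k : ℂ) + 1) * d k := by
    rw [← Finset.sum_range_reflect]
    refine Finset.sum_congr rfl fun k hk => ?_
    have hk' := Finset.mem_range.1 hk
    rw [hd k hk', Nat.cast_sub (by omega), Nat.cast_sub (by omega)]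
    push_cast
    ring
  rw [two_mul]
  nth_rewrite 1 [h1]
  rw [h1, h2, ← h2, Finset.mul_sum]
  nth_rewrite 2 [h2]
  rw [← Finset.sum_add_distrib]
  exact Finset.sum_congr rfl fun k _ => by ring

section TraceForm

variable {e : HilbertBasis ℕ ℂ H} {B V : H →L[ℂ] H}

theorem traceAlong_conj_word (hV : IsHS e V) (P Q R : H →L[ℂ] H) :
    traceAlong e (P * V * Q * V * R) = traceAlong e (V * Q * V * (R * P)) := by
  have h := traceAlong_mul_comm (hV.mul_left P) ((hV.mul_left Q).mul_right R)
  have h' := traceAlong_mul_comm ((hV.mul_left Q).mul_right (R * P)) hV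
  simp only [← mul_assoc] at h h' ⊢
  rw [h, h']

theorem traceAlong_mul_mul_mul_comm (hV : IsHS e V) (X Y : H →L[ℂ] H) :
    traceAlong e (V * X * V * Y) = traceAlong e (V * Y * V * X) := by
  have h := traceAlong_mul_comm (hV.mul_right X) (hV.mul_right Y)
  simpa only [← mul_assoc] using h

theorem traceAlong_D2pow_self (hV : IsHS e V) (r : ℕ) :
    traceAlong e (D2pow B V V r)
      = r * ∑ k ∈ Finset.range (r - 1), traceAlong e (V * B ^ k * V * B ^ (r - 1 - 1 - k)) := by
  obtain ⟨τ, hτ⟩ := exists_linearMap_eq_traceAlong e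
  have hw : ∀ P Q R : H →L[ℂ] H, τ (P * V * Q * V * R) = traceAlong e (V * Q * V * (R * P)) :=
    fun P Q R => by
      rw [hτ _ (mul_mem_hsProducts_right
        (((hV.mul_left P).mul_right Q).mul_mem_hsProducts hV) R), traceAlong_conj_word hV]
  rw [← hτ _ (D2pow_self_mem_hsProducts hV r)]
  rcases r with _ | N
  · simp [D2pow]
  have hIcc : ∀ (n : ℕ) (f : ℕ → H →L[ℂ] H),
      ∑ j ∈ Finset.Icc 1 n, f j = ∑ j ∈ Finset.range n, f (j + 1) := by
    intro n f
    rw [Finset.range_eq_Ico, Finset.sum_Ico_add' f 0 n 1]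
    rfl
  set d : ℕ → ℂ := fun k => traceAlong e (V * B ^ k * V * B ^ (N - 1 - k)) with hd
  have hsymm : ∀ k < N, d (N - 1 - k) = d k := fun k hk => by
    simp only [hd]
    rw [traceAlong_mul_mul_mul_comm hV, show N - 1 - (N - 1 - k) = k by omega]
  have h2 := two_mul_sum_range_sum_range_succ N d hsymm
  rw [D2pow, map_add, hIcc]
  simp only [map_sum, hw, ← pow_add, Nat.add_sub_cancel]
  have h3 : ∑ j ∈ Finset.range N, ∑ k ∈ Finset.range (N - j),
      traceAlong e (V * B ^ k * V * B ^ (j + (N + 1 - 2 - j - k)))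
      = ∑ j ∈ Finset.range N, ∑ k ∈ Finset.range (j + 1), d k := by
    rw [← Finset.sum_range_reflect]
    refine Finset.sum_congr rfl fun j hj => ?_
    have hj' := Finset.mem_range.1 hj
    refine Finset.sum_congr (by congr 1; omega) fun k hk => ?_
    have hk' := Finset.mem_range.1 hk
    simp only [hd]
    congr 3
    omega
  have h4 : ∑ j ∈ Finset.range N, ∑ k ∈ Finset.range (j + 1),
      traceAlong e (V * B ^ k * V * B ^ (j - k + (N - (j + 1))))
      = ∑ j ∈ Finset.range N, ∑ k ∈ Finset.range (j + 1), d k := by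
    refine Finset.sum_congr rfl fun j hj => ?_
    have hj' := Finset.mem_range.1 hj
    refine Finset.sum_congr rfl fun k hk => ?_
    have hk' := Finset.mem_range.1 hk
    simp only [hd]
    congr 3
    omega
  rw [h3, h4, ← two_mul, h2]
  push_cast
  rfl

theorem traceAlong_mul_mul_mul_im (hV : IsHS e V) (hVs : IsSelfAdjoint V) {X Y : H →L[ℂ] H}
    (hX : IsSelfAdjoint X) (hY : IsSelfAdjoint Y) : (traceAlong e (V * X * V * Y)).im = 0 := by
  rw [← Complex.conj_eq_iff_im, ← traceAlong_star]
  simp only [star_mul, hX.star_eq, hY.star_eq, hVs.star_eq]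
  have h := traceAlong_mul_comm hV ((hV.mul_left Y).mul_right X)
  rw [traceAlong_mul_mul_mul_comm hV]
  simp only [← mul_assoc] at h ⊢
  exact h.symm

/-- The real bilinear form `(X, Y) ↦ Re Tr (V X V Y)`. -/
def traceForm (e : HilbertBasis ℕ ℂ H) (V : H →L[ℂ] H) (hV : IsHS e V) :
    (H →L[ℂ] H) →ₗ[ℝ] (H →L[ℂ] H) →ₗ[ℝ] ℝ :=
  have hmem : ∀ X Y : H →L[ℂ] H, V * X * V * Y ∈ hsProducts e := fun X Y =>
    mul_mem_hsProducts_right ((hV.mul_right X).mul_mem_hsProducts hV) Y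
  have hadd : ∀ S ∈ hsProducts e, ∀ T ∈ hsProducts e,
      traceAlong e (S + T) = traceAlong e S + traceAlong e T := fun S hS T hT => by
    obtain ⟨τ, hτ⟩ := exists_linearMap_eq_traceAlong e
    rw [← hτ _ hS, ← hτ _ hT, ← hτ _ (add_mem hS hT), map_add]
  have hsmul : ∀ (c : ℝ), ∀ S ∈ hsProducts e,
      traceAlong e (c • S) = c * traceAlong e S := fun c S hS => by
    obtain ⟨τ, hτ⟩ := exists_linearMap_eq_traceAlong e
    rw [← Complex.coe_smul, ← hτ _ hS, ← hτ _ (Submodule.smul_mem _ _ hS), map_smul, smul_eq_mul]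
  LinearMap.mk₂ ℝ (fun X Y => (traceAlong e (V * X * V * Y)).re)
    (fun X X' Y => by
      rw [mul_add, add_mul, add_mul, hadd _ (hmem _ _) _ (hmem _ _), Complex.add_re])
    (fun c X Y => by
      rw [mul_smul_comm, smul_mul_assoc, smul_mul_assoc, hsmul _ _ (hmem _ _), Complex.re_ofReal_mul,
        smul_eq_mul])
    (fun X Y Y' => by
      rw [mul_add, hadd _ (hmem _ _) _ (hmem _ _), Complex.add_re])
    (fun c X Y => by
      rw [mul_smul_comm, hsmul _ _ (hmem _ _), Complex.re_ofReal_mul, smul_eq_mul])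

theorem traceForm_apply (hV : IsHS e V) (X Y : H →L[ℂ] H) :
    traceForm e V hV X Y = (traceAlong e (V * X * V * Y)).re := rfl

theorem abs_traceForm_le (hV : IsHS e V) (X Y : H →L[ℂ] H) :
    |traceForm e V hV X Y| ≤ hsNormSq e V * ‖X‖ * ‖Y‖ := by
  have h1 : ∀ X Y : H →L[ℂ] H, ‖X‖ ≤ 1 → ‖Y‖ ≤ 1 → |traceForm e V hV X Y| ≤ hsNormSq e V := by
    intro X Y hX hY
    rw [traceForm_apply, mul_assoc]
    refine (Complex.abs_re_le_norm _).trans ?_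
    refine (norm_traceAlong_mul_le (hV.mul_right X) (hV.mul_right Y)).trans ?_
    have h2 : ∀ Z : H →L[ℂ] H, ‖Z‖ ≤ 1 → hsNormSq e (V * Z) ≤ hsNormSq e V := fun Z hZ =>
      (hsNormSq_mul_right_le hV Z).trans
        (mul_le_of_le_one_left (hsNormSq_nonneg e V) (pow_le_one₀ (norm_nonneg Z) hZ))
    linarith [h2 X hX, h2 Y hY]
  rcases eq_or_ne X 0 with rfl | hX
  · simp
  rcases eq_or_ne Y 0 with rfl | hY
  · simp
  have hX' := norm_pos_iff.2 hX
  have hY' := norm_pos_iff.2 hY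
  have h3 := h1 (‖X‖⁻¹ • X) (‖Y‖⁻¹ • Y)
    (by rw [norm_smul, norm_inv, norm_norm, inv_mul_cancel₀ hX'.ne'])
    (by rw [norm_smul, norm_inv, norm_norm, inv_mul_cancel₀ hY'.ne'])
  rw [map_smul, map_smul, LinearMap.smul_apply, smul_eq_mul, smul_eq_mul, abs_mul, abs_mul,
    abs_of_pos (inv_pos.2 hX'), abs_of_pos (inv_pos.2 hY')] at h3
  field_simp at h3
  linarith

theorem continuous_traceForm (hV : IsHS e V) :
    Continuous fun q : (H →L[ℂ] H) × (H →L[ℂ] H) => traceForm e V hV q.1 q.2 :=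
  ((traceForm e V hV).mkContinuous₂ (hsNormSq e V) (abs_traceForm_le hV)).continuous₂

theorem traceForm_mul_self_nonneg (hV : IsHS e V) (hVs : IsSelfAdjoint V) {X Y : H →L[ℂ] H}
    (hX : IsSelfAdjoint X) (hY : IsSelfAdjoint Y) : 0 ≤ traceForm e V hV (X * X) (Y * Y) := by
  have h3 : traceAlong e (V * (X * X) * V * (Y * Y)) = traceAlong e (star (X * V * Y) * (X * V * Y)) := by
    have h4 := traceAlong_conj_word hV Y (X * X) Y
    rw [← h4]
    simp only [star_mul, hX.star_eq, hY.star_eq, hVs.star_eq, mul_assoc]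
  rw [traceForm_apply, h3, traceAlong_star_mul_self, Complex.ofReal_re]
  exact hsNormSq_nonneg _ _

theorem traceForm_one_one (hV : IsHS e V) (hVs : IsSelfAdjoint V) :
    traceForm e V hV 1 1 = hsNormSq e V := by
  rw [traceForm_apply, mul_one, mul_one, ← Complex.ofReal_re (hsNormSq e V),
    ← traceAlong_star_mul_self, hVs.star_eq]

end TraceForm

section DividedDifference

/-- The divided difference of the derivative of a polynomial `p`. -/
def derivDividedDiff (p : Polynomial ℝ) (x y : ℝ) : ℝ :=
  p.sum fun r c => c * (r * ∑ k ∈ Finset.range (r - 1), x ^ k * y ^ (r - 1 - 1 - k))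

theorem derivDividedDiff_mul_sub (p : Polynomial ℝ) (x y : ℝ) :
    derivDividedDiff p x y * (x - y) = p.derivative.eval x - p.derivative.eval y := by
  rw [Polynomial.derivative_eval, Polynomial.derivative_eval, derivDividedDiff, Polynomial.sum,
    Polynomial.sum, Polynomial.sum, Finset.sum_mul, ← Finset.sum_sub_distrib]
  refine Finset.sum_congr rfl fun r _ => ?_
  rw [mul_assoc, mul_assoc, geom_sum₂_mul]
  ring

theorem derivDividedDiff_self (p : Polynomial ℝ) (x : ℝ) :
    derivDividedDiff p x x = p.derivative.derivative.eval x := by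
  induction p using Polynomial.induction_on' with
  | add p q hp hq =>
    rw [derivDividedDiff, Polynomial.sum_add_index _ _ _ (by simp) (by intros; ring),
      ← derivDividedDiff, ← derivDividedDiff, hp, hq]
    simp
  | monomial n c =>
    rw [derivDividedDiff, Polynomial.sum_monomial_index _ _ (by simp), geom_sum₂_self,
      Polynomial.derivative_monomial, Polynomial.derivative_monomial, Polynomial.eval_monomial]
    ring

theorem abs_derivDividedDiff_le {p : Polynomial ℝ} {a b M : ℝ}
    (hM : ∀ x ∈ Set.Icc a b, |p.derivative.derivative.eval x| ≤ M) {x y : ℝ}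
    (hx : x ∈ Set.Icc a b) (hy : y ∈ Set.Icc a b) : |derivDividedDiff p x y| ≤ M := by
  rcases eq_or_ne x y with rfl | hxy
  · rw [derivDividedDiff_self]
    exact hM x hx
  have h := Convex.norm_image_sub_le_of_norm_hasDerivWithin_le (f := fun t => p.derivative.eval t)
    (f' := fun t => p.derivative.derivative.eval t) (s := Set.Icc a b) (C := M)
    (fun t _ => (p.derivative.hasDerivAt t).hasDerivWithinAt) hM (convex_Icc a b) hy hx
  simp only [Real.norm_eq_abs] at h
  rw [← derivDividedDiff_mul_sub, abs_mul] at h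
  exact le_of_mul_le_mul_right h (abs_pos.2 (sub_ne_zero.2 hxy))

theorem abs_sum_weighted_le {ι : Type*} [Fintype ι] {p : Polynomial ℝ} {a b M : ℝ}
    (hM : ∀ x ∈ Set.Icc a b, |p.derivative.derivative.eval x| ≤ M) {x : ι → ℝ}
    (hx : ∀ i, x i ∈ Set.Icc a b) {w : ι → ι → ℝ} (hw : ∀ i j, 0 ≤ w i j) :
    |p.sum fun r c => c * (r * ∑ k ∈ Finset.range (r - 1),
      ∑ i, ∑ j, w i j * (x i ^ k * x j ^ (r - 1 - 1 - k)))| ≤ M * ∑ i, ∑ j, w i j := by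
  have h : (p.sum fun r c => c * (r * ∑ k ∈ Finset.range (r - 1),
      ∑ i, ∑ j, w i j * (x i ^ k * x j ^ (r - 1 - 1 - k))))
      = ∑ i, ∑ j, w i j * derivDividedDiff p (x i) (x j) := by
    have hcomm : ∀ (s : Finset ℕ) (F : ℕ → ι → ι → ℝ),
        ∑ k ∈ s, ∑ i, ∑ j, F k i j = ∑ i, ∑ j, ∑ k ∈ s, F k i j := fun s F => by
      rw [Finset.sum_comm]
      exact Finset.sum_congr rfl fun i _ => Finset.sum_comm
    simp only [derivDividedDiff, Polynomial.sum, Finset.mul_sum]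
    rw [Finset.sum_congr rfl fun r _ => hcomm _ _, hcomm]
    refine Finset.sum_congr rfl fun i _ => Finset.sum_congr rfl fun j _ =>
      Finset.sum_congr rfl fun r _ => Finset.sum_congr rfl fun k _ => ?_
    ring
  rw [h, Finset.mul_sum]
  refine (Finset.abs_sum_le_sum_abs _ _).trans (Finset.sum_le_sum fun i _ => ?_)
  rw [Finset.mul_sum]
  refine (Finset.abs_sum_le_sum_abs _ _).trans (Finset.sum_le_sum fun j _ => ?_)
  rw [abs_mul, abs_of_nonneg (hw i j), mul_comm]
  exact mul_le_mul_of_nonneg_right (abs_derivDividedDiff_le hM (hx i) (hx j)) (hw i j)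

end DividedDifference

section KeyBound

variable {e : HilbertBasis ℕ ℂ H} {B V : H →L[ℂ] H}

theorem traceAlong_D2poly_self (hV : IsHS e V) (p : Polynomial ℝ) :
    traceAlong e (D2poly B V V p) = p.sum fun r c => (c : ℂ) * (r * ∑ k ∈ Finset.range (r - 1),
      traceAlong e (V * B ^ k * V * B ^ (r - 1 - 1 - k))) := by
  obtain ⟨τ, hτ⟩ := exists_linearMap_eq_traceAlong e
  rw [← hτ _ (D2poly_self_mem_hsProducts hV p), D2poly, Polynomial.sum, map_sum, Polynomial.sum]
  refine Finset.sum_congr rfl fun r _ => ?_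
  rw [← Complex.coe_smul, map_smul, hτ _ (D2pow_self_mem_hsProducts hV r),
    traceAlong_D2pow_self hV, smul_eq_mul]

theorem traceAlong_D2poly_self_eq (hV : IsHS e V) (hVs : IsSelfAdjoint V)
    (hB : IsSelfAdjoint B) (p : Polynomial ℝ) :
    traceAlong e (D2poly B V V p) = ((p.sum fun r c => c * (r * ∑ k ∈ Finset.range (r - 1),
      traceForm e V hV (B ^ k) (B ^ (r - 1 - 1 - k))) : ℝ) : ℂ) := by
  rw [traceAlong_D2poly_self hV, Polynomial.sum, Polynomial.sum]
  push_cast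
  refine Finset.sum_congr rfl fun r _ => ?_
  congr 2
  refine Finset.sum_congr rfl fun k _ => ?_
  rw [traceForm_apply]
  exact Complex.ext rfl (by
    simpa using traceAlong_mul_mul_mul_im hV hVs (hB.pow k) (hB.pow _))

theorem tendsto_traceForm (hV : IsHS e V) {X Y : ℕ → H →L[ℂ] H} {P Q : H →L[ℂ] H}
    (hX : Filter.Tendsto X Filter.atTop (nhds P)) (hY : Filter.Tendsto Y Filter.atTop (nhds Q)) :
    Filter.Tendsto (fun n => traceForm e V hV (X n) (Y n)) Filter.atTop
      (nhds (traceForm e V hV P Q)) := by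
  have h := continuous_traceForm hV
  generalize traceForm e V hV = F at h ⊢
  exact (h.tendsto (P, Q)).comp (hX.prodMk_nhds hY)

open unitInterval in
theorem exists_starAlgHom_unitInterval (hB : IsSelfAdjoint B) {a b : ℝ} (hab : a ≤ b)
    (hs : spectrum ℝ B ⊆ Set.Icc a b) :
    ∃ ψ : C(I, ℝ) →⋆ₐ[ℝ] (H →L[ℂ] H), Continuous ψ ∧
      ∀ u : C(I, ℝ), (∀ t, u t = a + (b - a) * t) → ψ u = B := by
  have hpos : 0 ≤ b - a := sub_nonneg.2 hab
  let g : C(spectrum ℝ B, I) :=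
    ⟨fun x => ⟨(x - a) / (b - a), div_nonneg (sub_nonneg.2 (hs x.2).1) hpos,
      div_le_one_of_le₀ (by linarith [(hs x.2).2]) hpos⟩, by fun_prop⟩
  refine ⟨(cfcHom hB).comp (ContinuousMap.compStarAlgHom' ℝ ℝ g),
    (cfcHom_continuous hB).comp (ContinuousMap.continuous_precomp g), fun u hu => ?_⟩
  rw [StarAlgHom.comp_apply]
  convert cfcHom_id hB (R := ℝ) using 2
  ext x
  simp only [ContinuousMap.compStarAlgHom'_apply, ContinuousMap.comp_apply, hu,
    ContinuousMap.restrict_apply, ContinuousMap.id_apply]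
  simp only [g, ContinuousMap.coe_mk]
  have hx := hs x.2
  rcases hab.eq_or_lt with rfl | hlt
  · simp [le_antisymm hx.1 hx.2]
  · rw [mul_div_cancel₀ _ (sub_pos.2 hlt).ne', add_sub_cancel]

open unitInterval in
theorem traceForm_map_nonneg (hV : IsHS e V) (hVs : IsSelfAdjoint V)
    (ψ : C(I, ℝ) →⋆ₐ[ℝ] (H →L[ℂ] H)) {f g : C(I, ℝ)} (hf : ∀ t, 0 ≤ f t) (hg : ∀ t, 0 ≤ g t) :
    0 ≤ traceForm e V hV (ψ f) (ψ g) := by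
  have h : ∀ f : C(I, ℝ), (∀ t, 0 ≤ f t) →
      ∃ X : H →L[ℂ] H, IsSelfAdjoint X ∧ ψ f = X * X := fun f hf => by
    refine ⟨ψ ⟨fun t => √(f t), by fun_prop⟩, ?_, ?_⟩
    · exact IsSelfAdjoint.map (ContinuousMap.ext fun t => by simp) ψ
    · rw [← map_mul]
      congr 1
      ext t
      exact (Real.mul_self_sqrt (hf t)).symm
  obtain ⟨X, hX, hfX⟩ := h f hf
  obtain ⟨Y, hY, hgY⟩ := h g hg
  rw [hfX, hgY]
  exact traceForm_mul_self_nonneg hV hVs hX hY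

open unitInterval in
theorem sum_bernstein (n : ℕ) : ∑ k : Fin (n + 1), bernstein n k = 1 := by
  ext t
  simp [bernstein.probability n t]

open unitInterval in
theorem map_bernsteinApproximation (ψ : C(I, ℝ) →⋆ₐ[ℝ] (H →L[ℂ] H)) (n : ℕ) (f : C(I, ℝ)) :
    ψ (bernsteinApproximation n f)
      = ∑ k : Fin (n + 1), f (bernstein.z k) • ψ (bernstein n k) := by
  rw [← Finset.sum_congr rfl fun k _ => map_smul ψ (f (bernstein.z k)) (bernstein n k), ← map_sum]
  congr 1
  ext t
  rw [bernsteinApproximation.apply]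
  simp [mul_comm]

open unitInterval in
theorem abs_sum_traceForm_le (hV : IsHS e V) (hVs : IsSelfAdjoint V) (hB : IsSelfAdjoint B)
    {a b M : ℝ} (hab : a ≤ b) (hs : spectrum ℝ B ⊆ Set.Icc a b) {p : Polynomial ℝ}
    (hM : ∀ x ∈ Set.Icc a b, |p.derivative.derivative.eval x| ≤ M) :
    |p.sum fun r c => c * (r * ∑ k ∈ Finset.range (r - 1),
      traceForm e V hV (B ^ k) (B ^ (r - 1 - 1 - k)))| ≤ M * hsNormSq e V := by
  obtain ⟨ψ, hψ, hψB⟩ := exists_starAlgHom_unitInterval hB hab hs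
  let u : C(I, ℝ) := ⟨fun t => a + (b - a) * t, by fun_prop⟩
  have hu : ∀ t, u t ∈ Set.Icc a b := fun t => by
    have h0 := t.2.1
    have h1 := t.2.2
    have := sub_nonneg.2 hab
    exact ⟨by simp only [u, ContinuousMap.coe_mk]; nlinarith,
      by simp only [u, ContinuousMap.coe_mk]; nlinarith⟩
  let X : ℕ → ℕ → H →L[ℂ] H := fun n k => ψ (bernsteinApproximation n (u ^ k))
  have hX : ∀ k, Filter.Tendsto (fun n => X n k) Filter.atTop (nhds (B ^ k)) := fun k => by
    have h := (hψ.tendsto _).comp (bernsteinApproximation_uniform (u ^ k))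
    rwa [map_pow, hψB u fun _ => rfl] at h
  let w : ∀ n : ℕ, Fin (n + 1) → Fin (n + 1) → ℝ := fun n i j =>
    traceForm e V hV (ψ (bernstein n i)) (ψ (bernstein n j))
  have hw : ∀ n i j, 0 ≤ w n i j := fun n i j =>
    traceForm_map_nonneg hV hVs ψ (fun _ => bernstein_nonneg) fun _ => bernstein_nonneg
  have hw1 : ∀ n, ∑ i, ∑ j, w n i j = hsNormSq e V := fun n => by
    have h1 : ∑ k : Fin (n + 1), ψ (bernstein n k) = 1 := by
      rw [← map_sum, sum_bernstein, map_one]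
    rw [← traceForm_one_one hV hVs]
    nth_rewrite 1 [← h1]
    nth_rewrite 1 [← h1]
    simp only [map_sum, LinearMap.sum_apply, w]
    rw [Finset.sum_comm]
  have hXform : ∀ n k l, traceForm e V hV (X n k) (X n l)
      = ∑ i, ∑ j, w n i j * (u (bernstein.z i) ^ k * u (bernstein.z j) ^ l) := fun n k l => by
    simp only [X, map_bernsteinApproximation, map_sum, map_smul, LinearMap.sum_apply,
      LinearMap.smul_apply, smul_eq_mul, w, ContinuousMap.pow_apply, Finset.mul_sum]
    rw [Finset.sum_comm]
    exact Finset.sum_congr rfl fun i _ => Finset.sum_congr rfl fun j _ => by ring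
  have hbound : ∀ n, |p.sum fun r c => c * (r * ∑ k ∈ Finset.range (r - 1),
      traceForm e V hV (X n k) (X n (r - 1 - 1 - k)))| ≤ M * hsNormSq e V := fun n => by
    simp only [hXform]
    rw [← hw1 n]
    exact abs_sum_weighted_le hM (fun i => hu _) (hw n)
  have hlim := fun k l => tendsto_traceForm hV (hX k) (hX l)
  refine le_of_tendsto (x := Filter.atTop) (Filter.Tendsto.abs ?_)
    (Filter.Eventually.of_forall hbound)
  exact tendsto_finsetSum _ fun r _ => ((tendsto_finsetSum _ fun k _ =>
      hlim k (r - 1 - 1 - k)).const_mul _).const_mul _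

end KeyBound

theorem norm_sub_sub_le_of_norm_second_deriv_le {E : Type*} [NormedAddCommGroup E]
    [NormedSpace ℝ E] {h h' h'' : ℝ → E} {K : ℝ} (h1 : ∀ s, HasDerivAt h (h' s) s)
    (h2 : ∀ s, HasDerivAt h' (h'' s) s) (hK : ∀ s ∈ Set.Icc (0 : ℝ) 1, ‖h'' s‖ ≤ K) :
    ‖h 1 - h 0 - h' 0‖ ≤ K / 2 := by
  have hd : ∀ s ∈ Set.Icc (0 : ℝ) 1, ‖h' s - h' 0‖ ≤ K * s := fun s hs =>
    image_norm_le_of_norm_deriv_right_le_deriv_boundary (f := fun s => h' s - h' 0)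
      (f' := h'') (B := fun s => K * s) (B' := fun _ => K)
      (fun s _ => ((h2 s).sub_const _).continuousAt.continuousWithinAt)
      (fun s _ => ((h2 s).sub_const _).hasDerivWithinAt) (by simp)
      (fun s => by simpa using (hasDerivAt_id s).const_mul K)
      (fun s hs => hK s (Set.Ico_subset_Icc_self hs)) hs
  have hder : ∀ s, HasDerivAt (fun s => h s - h 0 - s • h' 0) (h' s - h' 0) s := fun s => by
    simpa using ((h1 s).sub_const (h 0)).fun_sub ((hasDerivAt_id s).smul_const (h' 0))
  have := image_norm_le_of_norm_deriv_right_le_deriv_boundary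
      (f := fun s => h s - h 0 - s • h' 0)
      (f' := fun s => h' s - h' 0) (B := fun s => K / 2 * s ^ 2) (B' := fun s => K * s)
      (fun s _ => (hder s).continuousAt.continuousWithinAt)
      (fun s _ => (hder s).hasDerivWithinAt) (by simp)
      (fun s => by
        have h := (hasDerivAt_pow 2 s).const_mul (K / 2)
        rwa [show K / 2 * (((2 : ℕ) : ℝ) * s ^ (2 - 1)) = K * s by norm_num; ring] at h)
      (fun s hs => hd s (Set.Ico_subset_Icc_self hs)) (Set.right_mem_Icc.2 zero_le_one)
  simpa using this

theorem spectrum_add_smul_subset {A V : H →L[ℂ] H} (hA : IsSelfAdjoint A) (hV : IsSelfAdjoint V)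
    {s : ℝ} (hs : s ∈ Set.Icc (0 : ℝ) 1) :
    spectrum ℝ (A + (s : ℂ) • V)
      ⊆ Set.Icc (sInf (spectrum ℝ A) - ‖V‖) (sSup (spectrum ℝ A) + ‖V‖) := by
  have hsV : IsSelfAdjoint ((s : ℂ) • V) := by
    rw [Complex.coe_smul]
    exact (IsSelfAdjoint.all s).smul hV
  have hn : ‖(s : ℂ) • V‖ ≤ ‖V‖ := by
    rw [norm_smul, Complex.norm_real, Real.norm_of_nonneg hs.1]
    exact mul_le_of_le_one_left (norm_nonneg V) hs.2
  have hcpt : IsCompact (spectrum ℝ A) := spectrum.isCompact A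
  have hlow : algebraMap ℝ (H →L[ℂ] H) (sInf (spectrum ℝ A)) ≤ A :=
    (algebraMap_le_iff_le_spectrum hA).2 fun x hx => csInf_le hcpt.bddBelow hx
  have hupp : A ≤ algebraMap ℝ (H →L[ℂ] H) (sSup (spectrum ℝ A)) :=
    (le_algebraMap_iff_spectrum_le hA).2 fun x hx => le_csSup hcpt.bddAbove hx
  have hmono : algebraMap ℝ (H →L[ℂ] H) ‖(s : ℂ) • V‖ ≤ algebraMap ℝ (H →L[ℂ] H) ‖V‖ :=
    algebraMap_mono _ hn
  have h1 : (s : ℂ) • V ≤ algebraMap ℝ (H →L[ℂ] H) ‖V‖ :=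
    hsV.le_algebraMap_norm_self.trans hmono
  have h2 : -algebraMap ℝ (H →L[ℂ] H) ‖V‖ ≤ (s : ℂ) • V :=
    (neg_le_neg hmono).trans hsV.neg_algebraMap_norm_le_self
  intro x hx
  refine ⟨(algebraMap_le_iff_le_spectrum (hA.add hsV)).1 ?_ x hx,
    (le_algebraMap_iff_spectrum_le (hA.add hsV)).1 ?_ x hx⟩
  · rw [map_sub, sub_eq_add_neg]
    exact add_le_add hlow h2
  · rw [map_add]
    exact add_le_add hupp h1

section RemainderBound

variable {e : HilbertBasis ℕ ℂ H} {A V : H →L[ℂ] H} {a b : ℝ}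

theorem traceAlong_remainder3_bound (hV : IsHS e V) (hVs : IsSelfAdjoint V)
    (hA : IsSelfAdjoint A) (hab : a ≤ b)
    (hs : ∀ s ∈ Set.Icc (0 : ℝ) 1, spectrum ℝ (A + (s : ℂ) • V) ⊆ Set.Icc a b)
    {p : Polynomial ℝ} {M : ℝ}
    (hM : ∀ x ∈ Set.Icc a b, |p.derivative.derivative.eval x| ≤ M) :
    (traceAlong e (remainder3 A V p)).im = 0 ∧
      ‖traceAlong e (remainder3 A V p)‖ ≤ M * hsNormSq e V := by
  obtain ⟨τ, hτ⟩ := exists_linearMap_eq_traceAlong e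
  have h1 := hasDerivAt_linearMap_aeval τ A V p
  have h2 := hasDerivAt_linearMap_D1poly τ A V p
  have hB : ∀ s : ℝ, IsSelfAdjoint (A + (s : ℂ) • V) := fun s => by
    rw [Complex.coe_smul]
    exact hA.add ((IsSelfAdjoint.all s).smul hVs)
  have h3 : ∀ s : ℝ, (τ (D2poly (A + (s : ℂ) • V) V V p)).im = 0 := fun s => by
    rw [hτ _ (D2poly_self_mem_hsProducts hV p), traceAlong_D2poly_self_eq hV hVs (hB s),
      Complex.ofReal_im]
  have h4 : ∀ s ∈ Set.Icc (0 : ℝ) 1, ‖τ (D2poly (A + (s : ℂ) • V) V V p)‖ ≤ M * hsNormSq e V :=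
    fun s hs' => by
      rw [hτ _ (D2poly_self_mem_hsProducts hV p), traceAlong_D2poly_self_eq hV hVs (hB s),
        Complex.norm_real]
      exact abs_sum_traceForm_le hV hVs (hB s) hab (hs s hs') hM
  have hR : τ (remainder3 A V p) = τ (Polynomial.aeval (A + ((1 : ℝ) : ℂ) • V) p)
      - τ (Polynomial.aeval (A + ((0 : ℝ) : ℂ) • V) p) - τ (D1poly (A + ((0 : ℝ) : ℂ) • V) V p)
      - (1 / 2 : ℝ) • τ (D2poly (A + ((0 : ℝ) : ℂ) • V) V V p) := by
    rw [remainder3, ← Complex.coe_smul, map_sub, map_sub, map_sub, map_smul, Complex.coe_smul]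
    simp
  rw [← hτ _ (remainder3_mem_hsProducts hV p), hR]
  constructor
  · have h5 := norm_sub_sub_le_of_norm_second_deriv_le (K := 0)
      (fun s => Complex.imCLM.hasFDerivAt.comp_hasDerivAt s (h1 s))
      (fun s => Complex.imCLM.hasFDerivAt.comp_hasDerivAt s (h2 s))
      (fun s _ => by rw [Complex.imCLM_apply, h3 s, norm_zero])
    simp only [Function.comp_def, Complex.imCLM_apply, zero_div, norm_le_zero_iff] at h5
    rw [Complex.sub_im, Complex.sub_im, Complex.sub_im, h5, Complex.smul_im, h3, smul_zero,
      sub_zero]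
  · have h5 := norm_sub_sub_le_of_norm_second_deriv_le h1 h2 h4
    have h6 := h4 0 (Set.left_mem_Icc.2 zero_le_one)
    refine (norm_sub_le _ _).trans ?_
    rw [norm_smul]
    norm_num at h5 h6 ⊢
    linarith

theorem traceAlong_remainder3_integral_bound (hV : IsHS e V) (hVs : IsSelfAdjoint V)
    (hA : IsSelfAdjoint A) (hab : a ≤ b)
    (hs : ∀ s ∈ Set.Icc (0 : ℝ) 1, spectrum ℝ (A + (s : ℂ) • V) ⊆ Set.Icc a b)
    (p : Polynomial ℝ) :
    (traceAlong e (remainder3 A V p)).im = 0 ∧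
      ‖traceAlong e (remainder3 A V p)‖
        ≤ (∫ l in a..b, |p.derivative.derivative.derivative.eval l|) * hsNormSq e V := by
  set c := p.derivative.derivative.eval a with hc
  set q := p - (c / 2) • Polynomial.X ^ 2 with hq
  have hr : remainder3 A V p = remainder3 A V q := by
    change remainder3Linear A V p = remainder3Linear A V q
    rw [hq, map_sub, map_smul]
    change _ = _ - (c / 2) • remainder3 A V (Polynomial.X ^ 2)
    rw [remainder3_X_sq, smul_zero, sub_zero]
  have hq2 : ∀ x, q.derivative.derivative.eval x
      = p.derivative.derivative.eval x - p.derivative.derivative.eval a := fun x => by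
    rw [hq, ← hc]
    simp
  rw [hr]
  refine traceAlong_remainder3_bound hV hVs hA hab hs fun x hx => ?_
  have hcont : Continuous fun l => p.derivative.derivative.derivative.eval l :=
    Polynomial.continuous _
  rw [hq2, ← intervalIntegral.integral_eq_sub_of_hasDerivAt
    (fun l _ => p.derivative.derivative.hasDerivAt l) (hcont.intervalIntegrable _ _)]
  refine (intervalIntegral.abs_integral_le_integral_abs hx.1).trans ?_
  exact intervalIntegral.integral_mono_interval le_rfl hx.1 hx.2
    (Filter.Eventually.of_forall fun _ => abs_nonneg _) (hcont.abs.intervalIntegrable _ _)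

end RemainderBound

section Representation

variable {α : Type*} [TopologicalSpace α] [CompactSpace α] [MeasurableSpace α]
  [BorelSpace α] [SecondCountableTopologyEither α ℝ] (μ : Measure α) [IsFiniteMeasure μ]

theorem integral_abs_eq_inner_toLp_one (u : Lp ℝ 2 μ) :
    ∫ x, |u x| ∂μ = inner ℝ |u| (ContinuousMap.toLp 2 μ ℝ (1 : C(α, ℝ))) := by
  rw [L2.inner_def]
  refine integral_congr_ae ?_
  filter_upwards [Lp.coeFn_abs u, ContinuousMap.coeFn_toLp (p := 2) (𝕜 := ℝ) μ (1 : C(α, ℝ))]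
    with x h1 h2
  rw [h1, h2]
  simp

theorem continuous_integral_abs : Continuous fun u : Lp ℝ 2 μ => ∫ x, |u x| ∂μ := by
  simp only [integral_abs_eq_inner_toLp_one]
  have h : Continuous fun u : Lp ℝ 2 μ => |u| := continuous_id.sup continuous_neg
  exact h.inner continuous_const

theorem integral_abs_le_mul_norm (u : Lp ℝ 2 μ) :
    ∫ x, |u x| ∂μ ≤ ‖ContinuousMap.toLp 2 μ ℝ (1 : C(α, ℝ))‖ * ‖u‖ := by
  rw [integral_abs_eq_inner_toLp_one]
  refine (real_inner_le_norm _ _).trans ?_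
  rw [norm_abs_eq_norm, mul_comm]

theorem exists_integrable_representing [NormalSpace α] [μ.WeaklyRegular] {P : Type*} [AddCommGroup P] [Module ℝ P]
    (D : P →ₗ[ℝ] C(α, ℝ)) (hD : DenseRange D) (f : P →ₗ[ℝ] ℝ) {C : ℝ} (hC : 0 ≤ C)
    (hf : ∀ p, |f p| ≤ C * ∫ x, |D p x| ∂μ) :
    ∃ η : α → ℝ, Integrable η μ ∧ (∀ p, f p = ∫ x, D p x * η x ∂μ) ∧
      ∫ x, |η x| ∂μ ≤ C * μ.real Set.univ := by
  let ι : P →ₗ[ℝ] Lp ℝ 2 μ := (ContinuousMap.toLp 2 μ ℝ).toLinearMap ∘ₗ D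
  have hι : DenseRange ι :=
    (ContinuousMap.toLp_denseRange ℝ μ ℝ (p := 2) (by simp)).comp hD
      (ContinuousMap.toLp 2 μ ℝ).continuous
  have hιD : ∀ p, ι p =ᵐ[μ] D p := fun p => ContinuousMap.coeFn_toLp μ (D p)
  have hintegral : ∀ p, ∫ x, |ι p x| ∂μ = ∫ x, |D p x| ∂μ := fun p => by
    refine integral_congr_ae ?_
    filter_upwards [hιD p] with x hx
    rw [hx]
  set F : Lp ℝ 2 μ →L[ℝ] ℝ := f.extendOfNorm ι with hF
  have hFι : ∀ p, F (ι p) = f p := LinearMap.extendOfNorm_eq hι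
    ⟨C * ‖ContinuousMap.toLp 2 μ ℝ (1 : C(α, ℝ))‖, fun p => by
      rw [Real.norm_eq_abs, mul_assoc]
      refine (hf p).trans (mul_le_mul_of_nonneg_left ?_ hC)
      rw [← hintegral]
      exact integral_abs_le_mul_norm μ (ι p)⟩
  have hFle : ∀ u : Lp ℝ 2 μ, |F u| ≤ C * ∫ x, |u x| ∂μ := fun u =>
    hι.induction_on u (isClosed_le F.continuous.abs ((continuous_integral_abs μ).const_mul C))
      fun p => by
        rw [hFι, hintegral]
        exact hf p
  set η : Lp ℝ 2 μ := (InnerProductSpace.toDual ℝ (Lp ℝ 2 μ)).symm F with hη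
  have hFη : ∀ u : Lp ℝ 2 μ, F u = ∫ x, u x * η x ∂μ := fun u => by
    rw [← InnerProductSpace.toDual_symm_apply (𝕜 := ℝ) (x := u), L2.inner_def]
    rfl
  refine ⟨η, (Lp.memLp η).integrable (by norm_num), fun p => ?_, ?_⟩
  · rw [← hFι, hFη]
    refine integral_congr_ae ?_
    filter_upwards [hιD p] with x hx
    rw [hx]
  · have hsm : AEStronglyMeasurable (fun x => (SignType.sign (η x) : ℝ)) μ := by
      have h : Measurable fun t : ℝ => (SignType.sign t : ℝ) := by
        simp only [sign_apply, apply_ite ((↑) : SignType → ℝ)]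
        exact Measurable.ite measurableSet_Ioi measurable_const
          (Measurable.ite measurableSet_Iio measurable_const measurable_const)
      exact (h.comp_aemeasurable (Lp.aestronglyMeasurable η).aemeasurable).aestronglyMeasurable
    have hsb : ∀ t : ℝ, |(SignType.sign t : ℝ)| ≤ 1 := fun t => by
      rcases lt_trichotomy t 0 with h | h | h <;> simp [h]
    have hmem : MemLp (fun x => (SignType.sign (η x) : ℝ)) 2 μ :=
      MemLp.of_bound hsm 1 (Filter.Eventually.of_forall fun x => hsb _)
    set u := hmem.toLp with hu
    have hux : u =ᵐ[μ] fun x => (SignType.sign (η x) : ℝ) := hmem.coeFn_toLp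
    have h1 : ∫ x, |η x| ∂μ = F u := by
      rw [hFη]
      refine integral_congr_ae ?_
      filter_upwards [hux] with x hx
      rw [hx, sign_mul_self]
    have h2 : ∫ x, |u x| ∂μ ≤ μ.real Set.univ := by
      have h3 : ∫ x, |u x| ∂μ ≤ ∫ _, (1 : ℝ) ∂μ := by
        refine integral_mono_ae ((Lp.memLp u).integrable (by norm_num)).abs
          (integrable_const _) ?_
        filter_upwards [hux] with x hx
        rw [hx]
        exact hsb _
      simpa using h3
    rw [h1]
    exact (le_abs_self _).trans ((hFle u).trans (mul_le_mul_of_nonneg_left h2 hC))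

end Representation

theorem Polynomial.derivative_surjective_real :
    Function.Surjective (Polynomial.derivative : Polynomial ℝ →ₗ[ℝ] Polynomial ℝ) := fun p => by
  induction p using Polynomial.induction_on' with
  | add p q hp hq =>
    obtain ⟨r, rfl⟩ := hp
    obtain ⟨s, rfl⟩ := hq
    exact ⟨r + s, map_add _ _ _⟩
  | monomial n c =>
    refine ⟨Polynomial.monomial (n + 1) (c / (n + 1)), ?_⟩
    rw [Polynomial.derivative_monomial]
    have : (n : ℝ) + 1 ≠ 0 := by positivity
    push_cast
    rw [div_mul_cancel₀ _ this]

theorem exists_integrableOn_representing {a b : ℝ} (hab : a ≤ b) (f : Polynomial ℝ →ₗ[ℝ] ℝ)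
    {C : ℝ} (hC : 0 ≤ C)
    (hf : ∀ p : Polynomial ℝ,
      |f p| ≤ (∫ l in a..b, |p.derivative.derivative.derivative.eval l|) * C) :
    ∃ η : ℝ → ℝ, IntegrableOn η (Set.Icc a b) volume ∧
      (∀ p : Polynomial ℝ, f p = ∫ l in a..b, p.derivative.derivative.derivative.eval l * η l) ∧
      ∫ l in Set.Icc a b, |η l| ≤ (b - a) * C := by
  set μ : Measure (Set.Icc a b) := (volume : Measure ℝ).comap Subtype.val with hμ
  have hemb : MeasurableEmbedding (Subtype.val : Set.Icc a b → ℝ) :=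
    MeasurableEmbedding.subtype_coe measurableSet_Icc
  have huniv : μ Set.univ = ENNReal.ofReal (b - a) := by
    rw [hμ, hemb.comap_apply, Set.image_univ, Subtype.range_coe, Real.volume_Icc]
  have : IsFiniteMeasure μ := ⟨by rw [huniv]; exact ENNReal.ofReal_lt_top⟩
  have hintegral : ∀ g : ℝ → ℝ, ∫ x : Set.Icc a b, g x ∂μ = ∫ l in a..b, g l := fun g => by
    rw [intervalIntegral.integral_of_le hab, ← integral_Icc_eq_integral_Ioc]
    exact integral_subtype_comap measurableSet_Icc g
  let d := Polynomial.derivative (R := ℝ)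
  let D : Polynomial ℝ →ₗ[ℝ] C(Set.Icc a b, ℝ) :=
    (Polynomial.toContinuousMapOnAlgHom (Set.Icc a b)).toLinearMap ∘ₗ d ∘ₗ d ∘ₗ d
  have hDx : ∀ p x, D p x = p.derivative.derivative.derivative.eval (x : ℝ) := fun p x => rfl
  have hD : DenseRange D := by
    have h1 : DenseRange (Polynomial.toContinuousMapOnAlgHom (R := ℝ) (Set.Icc a b)) := by
      rw [DenseRange, ← polynomialFunctions_coe, dense_iff_closure_eq,
        ← Subalgebra.topologicalClosure_coe, polynomialFunctions_closure_eq_top]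
      rfl
    have h2 : Function.Surjective (d ∘ₗ d ∘ₗ d) := by
      have hd := Polynomial.derivative_surjective_real
      exact hd.comp (hd.comp hd)
    have h3 : Set.range D = Set.range (Polynomial.toContinuousMapOnAlgHom (R := ℝ) (Set.Icc a b)) :=
      h2.range_comp (Polynomial.toContinuousMapOnAlgHom (R := ℝ) (Set.Icc a b))
    rw [DenseRange, h3]
    exact h1
  obtain ⟨η, hη, hrep, hle⟩ := exists_integrable_representing μ D hD f hC fun p => by
    rw [mul_comm]
    refine (hf p).trans_eq ?_
    congr 1
    exact (hintegral fun l => |p.derivative.derivative.derivative.eval l|).symm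
  set η' : ℝ → ℝ := Function.extend Subtype.val η 0 with hη'
  have hext : ∀ x : Set.Icc a b, η' x = η x := fun x => Subtype.val_injective.extend_apply _ _ _
  refine ⟨η', ?_, fun p => ?_, ?_⟩
  · rw [integrableOn_iff_comap_subtypeVal measurableSet_Icc]
    convert hη using 1
    exact funext hext
  · rw [hrep, ← hintegral fun l => p.derivative.derivative.derivative.eval l * η' l]
    simp only [hext, hDx]
  · rw [← integral_subtype_comap measurableSet_Icc fun l => |η' l|]
    simp only [hext]
    refine hle.trans_eq ?_
    rw [measureReal_def, huniv, ENNReal.toReal_ofReal (sub_nonneg.2 hab), mul_comm]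

theorem ae_eq_of_integral_polynomial_mul_eq {a b : ℝ} (hab : a ≤ b) {η η' : ℝ → ℝ}
    (hη : IntegrableOn η (Set.Icc a b) volume) (hη' : IntegrableOn η' (Set.Icc a b) volume)
    (h : ∀ p : Polynomial ℝ, ∫ l in a..b, p.eval l * η' l = ∫ l in a..b, p.eval l * η l) :
    η' =ᵐ[volume.restrict (Set.Icc a b)] η := by
  set ν := volume.restrict (Set.Icc a b) with hν
  have hIcc : ∀ g : ℝ → ℝ, ∫ l in a..b, g l = ∫ l, g l ∂ν := fun g => by
    rw [intervalIntegral.integral_of_le hab, ← integral_Icc_eq_integral_Ioc]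
  have hmul : ∀ g : ℝ → ℝ, Continuous g → ∀ ζ : ℝ → ℝ, IntegrableOn ζ (Set.Icc a b) volume →
      Integrable (fun l => g l * ζ l) ν := fun g hg ζ hζ =>
    IntegrableOn.continuousOn_mul hg.continuousOn hζ isCompact_Icc
  have hζ : Integrable (fun l => η' l - η l) ν := Integrable.sub hη' hη
  have hpoly : ∀ p : Polynomial ℝ, ∫ l, p.eval l * (η' l - η l) ∂ν = 0 := fun p => by
    simp only [mul_sub]
    rw [integral_sub (hmul _ p.continuous _ hη') (hmul _ p.continuous _ hη), ← hIcc, ← hIcc, h,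
      sub_self]
  have hcont : ∀ g : ℝ → ℝ, Continuous g → ∫ l, g l * (η' l - η l) ∂ν = 0 := fun g hg => by
    have hle : ∀ ε > 0, |∫ l, g l * (η' l - η l) ∂ν| ≤ ε * ∫ l, |η' l - η l| ∂ν := fun ε hε => by
      obtain ⟨p, hp⟩ := exists_polynomial_near_of_continuousOn a b g hg.continuousOn ε hε
      rw [← sub_zero (∫ l, g l * (η' l - η l) ∂ν), ← hpoly p,
        ← integral_sub (hmul g hg _ hζ) (hmul _ p.continuous _ hζ), ← integral_const_mul]
      refine (abs_integral_le_integral_abs).trans (integral_mono_ae ?_ (hζ.abs.const_mul ε) ?_)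
      · exact ((hmul g hg _ hζ).sub (hmul _ p.continuous _ hζ)).abs
      · filter_upwards [ae_restrict_mem measurableSet_Icc] with l hl
        rw [← sub_mul, abs_mul, abs_sub_comm]
        exact mul_le_mul_of_nonneg_right (hp l hl).le (abs_nonneg _)
    refine abs_nonpos_iff.1 (le_of_forall_pos_le_add fun δ hδ => ?_)
    have hI : 0 ≤ ∫ l, |η' l - η l| ∂ν := integral_nonneg fun _ => abs_nonneg _
    refine (hle (δ / (∫ l, |η' l - η l| ∂ν + 1)) (by positivity)).trans ?_
    rw [zero_add, div_mul_eq_mul_div, div_le_iff₀ (by positivity)]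
    nlinarith
  have h0 := ae_eq_zero_of_integral_contDiff_smul_eq_zero hζ.locallyIntegrable
    fun g hg _ => hcont g hg.continuous
  filter_upwards [h0] with l hl
  exact sub_eq_zero.1 hl

/-- **Theorem 2.5 (third order trace formula, bounded case).**
Let `A, V` be bounded self-adjoint operators on a separable infinite-dimensional complex
Hilbert space with `V` Hilbert–Schmidt, and let `a = inf σ(A) − ‖V‖`, `b = sup σ(A) + ‖V‖`.
Then there is a unique real-valued `η ∈ L¹([a,b])` such that for every polynomial `p`,
`Tr[p(A+V) − p(A) − D¹p(A)(V) − ½D²p(A)(V,V)] = ∫_a^b p'''(λ) η(λ) dλ`;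
moreover `∫_a^b η(λ) dλ = (1/6)Tr(V³)` and `‖η‖_{L¹} ≤ (b−a)‖V‖₂²`. -/
theorem third_order_trace_formula_bounded
    (e : HilbertBasis ℕ ℂ H)
    (A V : H →L[ℂ] H) (hA : IsSelfAdjoint A) (hV : IsSelfAdjoint V) (hVHS : IsHS e V)
    (a b : ℝ)
    (ha : a = sInf (spectrum ℝ A) - ‖V‖) (hb : b = sSup (spectrum ℝ A) + ‖V‖) :
    ∃ η : ℝ → ℝ,
      IntegrableOn η (Set.Icc a b) volume ∧
      (∀ p : Polynomial ℝ,
        IsTraceClass e (remainder3 A V p) ∧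
        traceAlong e (remainder3 A V p)
          = ((∫ l in a..b,
              Polynomial.eval l (Polynomial.derivative (Polynomial.derivative
                (Polynomial.derivative p))) * η l : ℝ) : ℂ)) ∧
      ((∫ l in a..b, η l : ℝ) : ℂ) = (1 / 6 : ℂ) * traceAlong e (V ^ 3) ∧
      (∫ l in Set.Icc a b, |η l|) ≤ (b - a) * hsNormSq e V ∧
      (∀ η' : ℝ → ℝ,
        IntegrableOn η' (Set.Icc a b) volume →
        (∀ p : Polynomial ℝ,
          traceAlong e (remainder3 A V p)
            = ((∫ l in a..b,
                Polynomial.eval l (Polynomial.derivative (Polynomial.derivative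
                  (Polynomial.derivative p))) * η' l : ℝ) : ℂ)) →
        η' =ᶠ[ae (volume.restrict (Set.Icc a b))] η) := by
  have : Nontrivial H := ⟨e 0, 0, fun h => by simpa [h] using e.orthonormal.1 0⟩
  have hne : (spectrum ℝ A).Nonempty := ContinuousFunctionalCalculus.spectrum_nonempty A hA
  have hcpt : IsCompact (spectrum ℝ A) := spectrum.isCompact A
  have hab : a ≤ b := by
    have h1 := csInf_le_csSup hne hcpt.bddBelow hcpt.bddAbove
    have h2 := norm_nonneg V
    linarith
  have hs : ∀ s ∈ Set.Icc (0 : ℝ) 1, spectrum ℝ (A + (s : ℂ) • V) ⊆ Set.Icc a b := fun s hs => by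
    rw [ha, hb]
    exact spectrum_add_smul_subset hA hV hs
  have hbound := traceAlong_remainder3_integral_bound hVHS hV hA hab hs
  obtain ⟨τ, hτ⟩ := exists_linearMap_eq_traceAlong e
  let f : Polynomial ℝ →ₗ[ℝ] ℝ :=
    Complex.reLm ∘ₗ τ.restrictScalars ℝ ∘ₗ remainder3Linear A V
  have hf : ∀ p, f p = (traceAlong e (remainder3 A V p)).re := fun p => by
    rw [← hτ _ (remainder3_mem_hsProducts hVHS p)]
    rfl
  obtain ⟨η, hη, hrep, hle⟩ := exists_integrableOn_representing hab f (hsNormSq_nonneg e V)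
    fun p => by
      rw [hf]
      exact (Complex.abs_re_le_norm _).trans (hbound p).2
  have htr : ∀ p : Polynomial ℝ, traceAlong e (remainder3 A V p)
      = ((∫ l in a..b, p.derivative.derivative.derivative.eval l * η l : ℝ) : ℂ) := fun p => by
    rw [← hrep, hf]
    exact Complex.ext rfl (hbound p).1
  refine ⟨η, hη, fun p => ⟨isTraceClass_of_mem_hsProducts (remainder3_mem_hsProducts hVHS p),
    htr p⟩, ?_, hle, fun η' hη' h' => ?_⟩
  · have h := htr (Polynomial.X ^ 3)
    rw [remainder3_X_cube] at h
    have h6 : ∀ l : ℝ,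
        (Polynomial.X ^ 3 : Polynomial ℝ).derivative.derivative.derivative.eval l = 6 := fun l => by
      simp
      norm_num
    simp only [h6, intervalIntegral.integral_const_mul] at h
    rw [h]
    push_cast
    ring
  · refine ae_eq_of_integral_polynomial_mul_eq hab hη hη' fun q => ?_
    obtain ⟨q₁, rfl⟩ := Polynomial.derivative_surjective_real q
    obtain ⟨q₂, rfl⟩ := Polynomial.derivative_surjective_real q₁
    obtain ⟨q₃, rfl⟩ := Polynomial.derivative_surjective_real q₂
    exact_mod_cast (h' q₃).symm.trans (htr q₃)
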